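/- Recursive differential transform of a composed cosine: Let x : ℝ → ℝ be infinitely differentiable, let X be its differential transform, and let S and C be the differential transforms of the functions t ↦ sin(x(t)) and t ↦ cos(x(t)), respectively. Then for every k ≥ 1, k·C(k) = −Σ_{m=1}^{k} m·X(m)·S(k−m). -/

import Mathlib

/-- The differential transform (DT) of a function `x : ℝ → ℝ`:
`X(k) = (1/k!) · (d^k x/dt^k)(0)`, the k-th Taylor coefficient of `x` at 0. -/
noncomputable def DT (x : ℝ → ℝ) (k : ℕ) : ℝ :=
  (1 / (k.factorial : ℝ)) * iteratedDeriv k x 0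

theorem DT_deriv (f : ℝ → ℝ) (k : ℕ) : DT (deriv f) k = ((k + 1 : ℕ) : ℝ) * DT f (k + 1) := by
  unfold DT
  rw [iteratedDeriv_succ', Nat.factorial_succ]
  push_cast
  field_simp

theorem DT_neg (f : ℝ → ℝ) (k : ℕ) : DT (-f) k = -DT f k := by
  simp [DT, iteratedDeriv_neg]

theorem DT_mul {f g : ℝ → ℝ} {k : ℕ} (hf : ContDiffAt ℝ k f 0) (hg : ContDiffAt ℝ k g 0) :
    DT (f * g) k = ∑ i ∈ Finset.range (k + 1), DT f i * DT g (k - i) := by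
  unfold DT
  rw [iteratedDeriv_mul hf hg, Finset.mul_sum]
  refine Finset.sum_congr rfl fun i hi => ?_
  rw [Nat.cast_choose ℝ (Finset.mem_range_succ_iff.mp hi)]
  field_simp

theorem cosine_composition_recursion (x : ℝ → ℝ) (hx : ContDiff ℝ (⊤ : ℕ∞) x) :
    ∀ k : ℕ, 1 ≤ k →
      (k : ℝ) * DT (fun t => Real.cos (x t)) k =
        -∑ m ∈ Finset.Icc 1 k,
          (m : ℝ) * DT x m * DT (fun t => Real.sin (x t)) (k - m) := by
  intro k hk
  obtain ⟨n, rfl⟩ := Nat.exists_eq_add_of_le' hk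
  have hderiv : deriv (fun t => Real.cos (x t)) = -(deriv x * fun t => Real.sin (x t)) := by
    funext t
    simp [deriv_cos (hx.differentiable (by simp) t), mul_comm]
  have hx' : ContDiff ℝ n (deriv x) :=
    ((contDiff_succ_iff_deriv (n := n)).mp (hx.of_le (by exact_mod_cast le_top))).2.2
  have hsin : ContDiff ℝ n fun t => Real.sin (x t) :=
    (hx.of_le (by exact_mod_cast le_top)).sin
  rw [← DT_deriv, hderiv, DT_neg, DT_mul hx'.contDiffAt hsin.contDiffAt,
    ← Finset.Ico_add_one_right_eq_Icc, Finset.sum_Ico_eq_sum_range]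
  simp only [DT_deriv, Nat.add_sub_cancel, add_comm 1, Nat.add_sub_add_right]
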